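/- Boundedness of S_0^α when η ≥ α (second Proposition thmBound, case y = 0): let α > -1, β > 0, η > 0 with η ≥ α, and fix I ∈ ℍ with I² = -1. Then there exists a constant C > 0 such that for every measurable φ : (0,∞) → ℍ with ∫_0^∞ ‖φ(x)‖² x^α e^{-x} dx < ∞, ∫∫_{{u²+v²<1}} ‖S_0^α φ(u+vI)‖² ω_{β,η}(u²+v²) du dv ≤ C · ∫_0^∞ ‖φ(x)‖² x^α e^{-x} dx. -/

import Mathlib

open MeasureTheory Real Quaternion

/-- Generalized Laguerre polynomial `L_n^{(α)}(x)`. -/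
noncomputable def genLaguerre (α : ℝ) (n : ℕ) (x : ℝ) : ℝ :=
  ∑ k ∈ Finset.range (n + 1),
    ((-1 : ℝ) ^ k / (Nat.factorial k)) *
      (Real.Gamma (n + α + 1) / (Real.Gamma (k + α + 1) * (Nat.factorial (n - k)))) * x ^ k

/-- Normalized Laguerre function `φ_n^α(x)`. -/
noncomputable def lagPhi (α : ℝ) (n : ℕ) (x : ℝ) : ℝ :=
  Real.sqrt ((Nat.factorial n : ℝ) / Real.Gamma (n + α + 1)) * genLaguerre α n x

/-- Weight `ω_{β,η}(t) = t^{β-1}(1-t)^{η-1}`. -/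
noncomputable def weightBeta (β η t : ℝ) : ℝ := t ^ (β - 1) * (1 - t) ^ (η - 1)

/-- The kernel `R_q^α(x,y) = Σ_n qⁿ φ_n^α(x) φ_n^α(y)`. -/
noncomputable def Rker (α : ℝ) (q : ℍ[ℝ]) (x y : ℝ) : ℍ[ℝ] :=
  ∑' n : ℕ, (lagPhi α n x * lagPhi α n y) • q ^ n

/-- The dual transform `S_y^α φ(q) = ∫_0^∞ R_q^α(x,y) φ(x) x^α e^{-x} dx`. -/
noncomputable def Sdual (α y : ℝ) (φ : ℝ → ℍ[ℝ]) (q : ℍ[ℝ]) : ℍ[ℝ] :=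
  ∫ x in Set.Ioi (0 : ℝ), (x ^ α * Real.exp (-x)) • (Rker α q x y * φ x)

noncomputable def lagMu (α : ℝ) : Measure ℝ :=
  (volume.restrict (Set.Ioi (0 : ℝ))).withDensity
    (fun x => ((x ^ α * Real.exp (-x)).toNNReal : ENNReal))

lemma lagMu_meas (α : ℝ) : Measurable (fun x : ℝ => (x ^ α * Real.exp (-x)).toNNReal) := by
  fun_prop

lemma lagMu_integral {E : Type*} [NormedAddCommGroup E] [NormedSpace ℝ E] (α : ℝ) (g : ℝ → E) :
    ∫ x, g x ∂(lagMu α) = ∫ x in Set.Ioi (0 : ℝ), (x ^ α * Real.exp (-x)) • g x := by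
  unfold lagMu
  rw [integral_withDensity_eq_integral_smul (lagMu_meas α)]
  refine setIntegral_congr_fun measurableSet_Ioi fun x hx => ?_
  have hx' : (0 : ℝ) < x := hx
  simp only [NNReal.smul_def]
  rw [Real.coe_toNNReal _ (by positivity)]

lemma lagMu_lintegral (α : ℝ) (g : ℝ → ℝ) (hg : ∀ x, 0 ≤ g x) :
    ∫⁻ x, ENNReal.ofReal (g x) ∂(lagMu α) =
      ∫⁻ x in Set.Ioi (0 : ℝ), ENNReal.ofReal (g x * (x ^ α * Real.exp (-x))) := by
  unfold lagMu
  rw [lintegral_withDensity_eq_lintegral_mul_non_measurable _ (by fun_prop)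
    (Filter.Eventually.of_forall fun x => ENNReal.coe_lt_top)]
  refine setLIntegral_congr_fun measurableSet_Ioi fun x hx => ?_
  simp only [Pi.mul_apply]
  rw [mul_comm, ENNReal.ofReal_mul (hg x)]
  rfl

lemma lagMu_integrable_pow (α : ℝ) (hα : -1 < α) (m : ℕ) :
    Integrable (fun x : ℝ => x ^ m) (lagMu α) := by
  unfold lagMu
  rw [integrable_withDensity_iff_integrable_smul (lagMu_meas α)]
  have h := Real.GammaIntegral_convergent (s := m + α + 1) (by linarith [(Nat.cast_nonneg m : (0:ℝ) ≤ m)])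
  refine (integrableOn_congr_fun (fun x hx => ?_) measurableSet_Ioi).mp h
  have hx' : (0 : ℝ) < x := hx
  simp only [NNReal.smul_def]
  rw [Real.coe_toNNReal _ (by positivity), smul_eq_mul, show (m + α + 1 - 1 : ℝ) = α + m by ring,
    Real.rpow_add hx', Real.rpow_natCast]
  ring

lemma lagMu_integral_pow (α : ℝ) (hα : -1 < α) (m : ℕ) :
    ∫ x : ℝ, x ^ m ∂(lagMu α) = Real.Gamma (m + α + 1) := by
  rw [lagMu_integral, Real.Gamma_eq_integral (by linarith [(Nat.cast_nonneg m : (0:ℝ) ≤ m)])]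
  refine setIntegral_congr_fun measurableSet_Ioi fun x hx => ?_
  have hx' : (0 : ℝ) < x := hx
  rw [smul_eq_mul, show (m + α + 1 - 1 : ℝ) = α + m by ring,
    Real.rpow_add hx', Real.rpow_natCast]
  ring

lemma lagMu_integrable_poly (α : ℝ) (hα : -1 < α) (P : Polynomial ℝ) :
    Integrable (fun x : ℝ => P.eval x) (lagMu α) := by
  simp_rw [Polynomial.eval_eq_sum_range]
  exact integrable_finsetSum _ fun i _ => (lagMu_integrable_pow α hα i).const_mul _

noncomputable def genLagP (α : ℝ) (n : ℕ) : Polynomial ℝ :=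
  ∑ k ∈ Finset.range (n + 1),
    Polynomial.C (((-1 : ℝ) ^ k / (Nat.factorial k)) *
      (Real.Gamma (n + α + 1) / (Real.Gamma (k + α + 1) * (Nat.factorial (n - k))))) *
        Polynomial.X ^ k

lemma genLagP_eval (α : ℝ) (n : ℕ) (x : ℝ) : (genLagP α n).eval x = genLaguerre α n x := by
  simp [genLagP, genLaguerre, Polynomial.eval_finsetSum]

lemma Gamma_add_nat_eq (s : ℝ) (hs : 0 < s) (m : ℕ) :
    Real.Gamma (s + m) = (ascPochhammer ℝ m).eval s * Real.Gamma s := by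
  induction m with
  | zero => simp
  | succ m ih =>
    rw [ascPochhammer_succ_eval, Nat.cast_succ, ← add_assoc,
      Real.Gamma_add_one (by positivity), ih]
    ring

noncomputable def shiftPoch (α : ℝ) (m : ℕ) : Polynomial ℝ :=
  (ascPochhammer ℝ m).comp (Polynomial.X + Polynomial.C (α + 1))

lemma shiftPoch_natDegree (α : ℝ) (m : ℕ) : (shiftPoch α m).natDegree = m := by
  rw [shiftPoch, Polynomial.natDegree_comp, ascPochhammer_natDegree, Polynomial.natDegree_X_add_C, mul_one]

lemma shiftPoch_monic (α : ℝ) (m : ℕ) : (shiftPoch α m).Monic :=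
  Polynomial.Monic.comp_X_add_C (monic_ascPochhammer ℝ m) _

lemma lag_moment (α : ℝ) (hα : -1 < α) (n m : ℕ) :
    ∫ x : ℝ, x ^ m * genLaguerre α n x ∂(lagMu α) =
      Real.Gamma (n + α + 1) / n.factorial * (-1) ^ n * (fwdDiff 1)^[n] (shiftPoch α m).eval 0 := by
  rw [fwdDiff_iter_eq_sum_shift, Finset.mul_sum]
  unfold genLaguerre
  simp_rw [Finset.mul_sum]
  rw [integral_finsetSum]
  · refine Finset.sum_congr rfl fun k hk => ?_
    have hk' : k ≤ n := by simpa [Nat.lt_succ_iff] using hk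
    have e : ∀ x : ℝ, x ^ m * ((-1 : ℝ) ^ k / (Nat.factorial k) *
      (Real.Gamma (n + α + 1) / (Real.Gamma (k + α + 1) * (Nat.factorial (n - k)))) * x ^ k) =
      ((-1 : ℝ) ^ k / (Nat.factorial k) *
      (Real.Gamma (n + α + 1) / (Real.Gamma (k + α + 1) * (Nat.factorial (n - k))))) * x ^ (m + k) :=
      fun x => by ring
    simp_rw [e]
    rw [integral_const_mul, lagMu_integral_pow α hα]
    have hpos : (0 : ℝ) < k + α + 1 := by
      have : (0:ℝ) ≤ k := Nat.cast_nonneg k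
      linarith
    have h2 := Gamma_add_nat_eq _ hpos m
    rw [show ((m + k : ℕ) : ℝ) + α + 1 = k + α + 1 + m by push_cast; ring, h2]
    have hG := (Real.Gamma_pos_of_pos hpos).ne'
    have hc : (n.choose k : ℝ) = n.factorial / (k.factorial * (n - k).factorial) := by
      rw [Nat.cast_choose ℝ hk']
    have hs : (-1 : ℝ) ^ n * (-1) ^ (n - k) = (-1) ^ k := by
      rw [← pow_add]
      obtain ⟨j, rfl⟩ := Nat.exists_eq_add_of_le hk'
      rw [Nat.add_sub_cancel_left, show k + j + j = k + 2 * j by ring, pow_add, pow_mul]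
      simp
    have hev : (shiftPoch α m).eval (0 + k • (1 : ℝ)) = (ascPochhammer ℝ m).eval (k + α + 1) := by
      simp [shiftPoch, Polynomial.eval_comp, add_assoc]
    rw [hev, zsmul_eq_mul]
    push_cast
    rw [hc, ← hs]
    have := n.factorial_ne_zero
    have := k.factorial_ne_zero
    have := (n - k).factorial_ne_zero
    field_simp
  · intro k _
    have e : ∀ x : ℝ, x ^ m * ((-1 : ℝ) ^ k / (Nat.factorial k) *
      (Real.Gamma (n + α + 1) / (Real.Gamma (k + α + 1) * (Nat.factorial (n - k)))) * x ^ k) =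
      ((-1 : ℝ) ^ k / (Nat.factorial k) *
      (Real.Gamma (n + α + 1) / (Real.Gamma (k + α + 1) * (Nat.factorial (n - k))))) * x ^ (m + k) :=
      fun x => by ring
    simp_rw [e]
    exact (lagMu_integrable_pow α hα _).const_mul _

lemma lag_moment_lt (α : ℝ) (hα : -1 < α) (n m : ℕ) (h : m < n) :
    ∫ x : ℝ, x ^ m * genLaguerre α n x ∂(lagMu α) = 0 := by
  rw [lag_moment α hα, Polynomial.fwdDiff_iter_eq_zero_of_degree_lt
    (by rw [shiftPoch_natDegree]; exact h)]
  simp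

lemma lag_moment_self (α : ℝ) (hα : -1 < α) (n : ℕ) :
    ∫ x : ℝ, x ^ n * genLaguerre α n x ∂(lagMu α) = (-1) ^ n * Real.Gamma (n + α + 1) := by
  rw [lag_moment α hα]
  have h := Polynomial.fwdDiff_iter_degree_eq_factorial (shiftPoch α n)
  rw [shiftPoch_natDegree, (shiftPoch_monic α n).leadingCoeff] at h
  rw [h]
  have := n.factorial_ne_zero
  simp
  field_simp

lemma lag_int_prod (α : ℝ) (hα : -1 < α) (n m : ℕ) (hmn : m ≤ n) :
    ∫ x : ℝ, genLaguerre α m x * genLaguerre α n x ∂(lagMu α) =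
      if m = n then Real.Gamma (n + α + 1) / n.factorial else 0 := by
  have e : ∀ x : ℝ, genLaguerre α m x * genLaguerre α n x = ∑ k ∈ Finset.range (m + 1),
    (((-1 : ℝ) ^ k / (Nat.factorial k)) *
      (Real.Gamma (m + α + 1) / (Real.Gamma (k + α + 1) * (Nat.factorial (m - k))))) *
        (x ^ k * genLaguerre α n x) := by
    intro x
    conv_lhs => rw [genLaguerre, Finset.sum_mul]
    exact Finset.sum_congr rfl fun k _ => by ring
  simp_rw [e]
  rw [integral_finsetSum]
  · simp_rw [integral_const_mul]
    rw [Finset.sum_range_succ, Finset.sum_eq_zero, zero_add]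
    · split_ifs with h
      · subst h
        rw [lag_moment_self α hα]
        have hpos : (0 : ℝ) < m + α + 1 := by
          have : (0:ℝ) ≤ m := Nat.cast_nonneg m
          linarith
        have hG := (Real.Gamma_pos_of_pos hpos).ne'
        have := m.factorial_ne_zero
        simp
        field_simp
        rw [← pow_mul, mul_comm, pow_mul]
        simp
      · rw [lag_moment_lt α hα _ _ (lt_of_le_of_ne hmn h), mul_zero]
    · intro k hk
      rw [lag_moment_lt α hα _ _ ((Finset.mem_range.mp hk).trans_le hmn), mul_zero]
  · intro k _
    refine Integrable.const_mul ?_ _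
    have := lagMu_integrable_poly α hα (Polynomial.X ^ k * genLagP α n)
    simpa [genLagP_eval] using this

lemma lagPhi_orth (α : ℝ) (hα : -1 < α) (n m : ℕ) :
    ∫ x : ℝ, lagPhi α m x * lagPhi α n x ∂(lagMu α) = if m = n then 1 else 0 := by
  wlog hmn : m ≤ n generalizing m n
  · have := this m n (by omega)
    simp_rw [mul_comm (lagPhi α n _)] at this
    rw [this]
    simp [eq_comm]
  have e : ∀ x : ℝ, lagPhi α m x * lagPhi α n x =
      (Real.sqrt ((Nat.factorial m : ℝ) / Real.Gamma (m + α + 1)) *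
      Real.sqrt ((Nat.factorial n : ℝ) / Real.Gamma (n + α + 1))) *
        (genLaguerre α m x * genLaguerre α n x) := fun x => by unfold lagPhi; ring
  simp_rw [e]
  rw [integral_const_mul, lag_int_prod α hα n m hmn]
  split_ifs with h
  · subst h
    have hpos : (0 : ℝ) < m + α + 1 := by
      have : (0:ℝ) ≤ m := Nat.cast_nonneg m
      linarith
    have hG := (Real.Gamma_pos_of_pos hpos)
    rw [Real.mul_self_sqrt (by positivity)]
    have := m.factorial_ne_zero
    field_simp
  · simp

lemma lagPhi_integrable_mul (α : ℝ) (hα : -1 < α) (n m : ℕ) :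
    Integrable (fun x : ℝ => lagPhi α m x * lagPhi α n x) (lagMu α) := by
  have := lagMu_integrable_poly α hα (Polynomial.C (Real.sqrt ((Nat.factorial m : ℝ) / Real.Gamma (m + α + 1))) * genLagP α m * (Polynomial.C (Real.sqrt ((Nat.factorial n : ℝ) / Real.Gamma (n + α + 1))) * genLagP α n))
  simpa [genLagP_eval, lagPhi] using this

lemma lagPhi_continuous (α : ℝ) (n : ℕ) : Continuous (lagPhi α n) := by
  unfold lagPhi genLaguerre
  fun_prop

lemma lagPhi_zero_sq (α : ℝ) (hα : -1 < α) (n : ℕ) :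
    lagPhi α n 0 ^ 2 = Real.Gamma (n + α + 1) / (n.factorial * Real.Gamma (α + 1) ^ 2) := by
  have hL : genLaguerre α n 0 = Real.Gamma (n + α + 1) / (Real.Gamma (α + 1) * n.factorial) := by
    unfold genLaguerre
    rw [Finset.sum_range_succ', Finset.sum_eq_zero]
    · simp
    · intro k _; simp
  have hpos : (0 : ℝ) < n + α + 1 := by
    have : (0:ℝ) ≤ n := Nat.cast_nonneg n
    linarith
  have hG := (Real.Gamma_pos_of_pos hpos)
  have hG2 := (Real.Gamma_pos_of_pos (show 0 < α + 1 by linarith))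
  have := n.factorial_ne_zero
  rw [lagPhi, mul_pow, Real.sq_sqrt (by positivity), hL]
  field_simp

section bessel
variable {E : Type*} [NormedAddCommGroup E] [InnerProductSpace ℝ E]

lemma lag_smul_integrable (α : ℝ) (hα : -1 < α) (φ : ℝ → E)
    (hm : AEStronglyMeasurable φ (lagMu α)) (hi : Integrable (fun x => ‖φ x‖ ^ 2) (lagMu α))
    (n : ℕ) : Integrable (fun x => lagPhi α n x • φ x) (lagMu α) := by
  have h1 := (lagPhi_integrable_mul α hα n n).add hi
  refine h1.mono' ((lagPhi_continuous α n).aestronglyMeasurable.smul hm) ?_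
  filter_upwards with x
  rw [norm_smul, Real.norm_eq_abs]
  simp only [Pi.add_apply]
  rw [← abs_mul_abs_self]
  nlinarith [sq_nonneg (|lagPhi α n x| - ‖φ x‖), sq_nonneg (|lagPhi α n x|), sq_nonneg ‖φ x‖]

lemma lag_norm_bound (α : ℝ) (hα : -1 < α) (φ : ℝ → E)
    (hm : AEStronglyMeasurable φ (lagMu α)) (hi : Integrable (fun x => ‖φ x‖ ^ 2) (lagMu α))
    (n : ℕ) : ∫ x, ‖lagPhi α n x • φ x‖ ∂(lagMu α) ≤ 1 + ∫ x, ‖φ x‖ ^ 2 ∂(lagMu α) := by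
  have h0 := lagPhi_orth α hα n n
  rw [if_pos rfl] at h0
  rw [← h0, ← integral_add (lagPhi_integrable_mul α hα n n) hi]
  refine integral_mono (lag_smul_integrable α hα φ hm hi n).norm
    ((lagPhi_integrable_mul α hα n n).add hi) fun x => ?_
  simp only [norm_smul, Real.norm_eq_abs]
  rw [← abs_mul_abs_self]
  nlinarith [sq_nonneg (|lagPhi α n x| - ‖φ x‖), sq_nonneg (|lagPhi α n x|), sq_nonneg ‖φ x‖]

lemma lag_bessel [CompleteSpace E] (α : ℝ) (hα : -1 < α) (φ : ℝ → E)
    (hm : AEStronglyMeasurable φ (lagMu α)) (hi : Integrable (fun x => ‖φ x‖ ^ 2) (lagMu α))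
    (N : ℕ) : ∑ n ∈ Finset.range N, ‖∫ x, lagPhi α n x • φ x ∂(lagMu α)‖ ^ 2 ≤
      ∫ x, ‖φ x‖ ^ 2 ∂(lagMu α) := by
  set a : ℕ → E := fun n => ∫ x, lagPhi α n x • φ x ∂(lagMu α) with ha
  have hint := lag_smul_integrable α hα φ hm hi
  have e : ∀ x, ‖φ x - ∑ n ∈ Finset.range N, lagPhi α n x • a n‖ ^ 2 =
      (‖φ x‖ ^ 2 - 2 * ∑ n ∈ Finset.range N, inner ℝ (a n) (lagPhi α n x • φ x)) +
      ∑ n ∈ Finset.range N, ∑ m ∈ Finset.range N,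
        (lagPhi α n x * lagPhi α m x) * inner ℝ (a n) (a m) := by
    intro x
    rw [norm_sub_sq_real]
    congr 2
    · rw [inner_sum]
      congr 1
      refine Finset.sum_congr rfl fun n _ => ?_
      rw [inner_smul_right, inner_smul_right, real_inner_comm]
    · rw [← real_inner_self_eq_norm_sq, sum_inner]
      refine Finset.sum_congr rfl fun n _ => ?_
      rw [inner_sum]
      refine Finset.sum_congr rfl fun m _ => ?_
      rw [inner_smul_right, real_inner_smul_left]
      ring
  have hI1 : ∀ n, Integrable (fun x => inner ℝ (a n) (lagPhi α n x • φ x)) (lagMu α) :=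
    fun n => (hint n).const_inner (a n)
  have hI1s : Integrable (fun x => ∑ n ∈ Finset.range N, inner ℝ (a n) (lagPhi α n x • φ x)) (lagMu α) :=
    integrable_finsetSum _ fun n _ => hI1 n
  have hI2 : ∀ n m, Integrable (fun x => (lagPhi α n x * lagPhi α m x) * inner ℝ (a n) (a m)) (lagMu α) :=
    fun n m => (lagPhi_integrable_mul α hα m n).mul_const _
  have hI2s : ∀ n, Integrable (fun x => ∑ m ∈ Finset.range N,
        (lagPhi α n x * lagPhi α m x) * inner ℝ (a n) (a m)) (lagMu α) :=
    fun n => integrable_finsetSum _ fun m _ => hI2 n m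
  have h0 : 0 ≤ ∫ x, ‖φ x - ∑ n ∈ Finset.range N, lagPhi α n x • a n‖ ^ 2 ∂(lagMu α) :=
    integral_nonneg fun x => by positivity
  simp_rw [e] at h0
  have hsub : Integrable (fun x => ‖φ x‖ ^ 2 - 2 * ∑ n ∈ Finset.range N,
      inner ℝ (a n) (lagPhi α n x • φ x)) (lagMu α) := hi.sub (hI1s.const_mul 2)
  rw [integral_add hsub (integrable_finsetSum _ fun n _ => hI2s n),
    integral_sub hi (hI1s.const_mul 2), integral_const_mul,
    integral_finsetSum _ (fun n _ => hI1 n), integral_finsetSum _ (fun n _ => hI2s n)] at h0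
  have h1 : ∀ n, ∫ x, inner ℝ (a n) (lagPhi α n x • φ x) ∂(lagMu α) = ‖a n‖ ^ 2 := by
    intro n
    rw [integral_inner (hint n), real_inner_self_eq_norm_sq]
  have h2 : ∀ n ∈ Finset.range N, ∫ x, ∑ m ∈ Finset.range N,
        (lagPhi α n x * lagPhi α m x) * inner ℝ (a n) (a m) ∂(lagMu α) = ‖a n‖ ^ 2 := by
    intro n hn
    rw [integral_finsetSum _ (fun m _ => hI2 n m)]
    simp_rw [integral_mul_const, lagPhi_orth α hα]
    simp only [ite_mul, one_mul, zero_mul, Finset.sum_ite_eq, hn, if_true, real_inner_self_eq_norm_sq]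
  rw [Finset.sum_congr rfl h2] at h0
  simp_rw [h1] at h0
  linarith

end bessel

lemma lagPhi_zero_summable (α : ℝ) (hα : -1 < α) (r : ℝ) (hr0 : 0 ≤ r) (hr : r < 1) :
    Summable (fun n : ℕ => |lagPhi α n 0| * r ^ n) := by
  have hsq : Summable (fun n : ℕ => lagPhi α n 0 ^ 2 * r ^ n) := by
    rcases hr0.eq_or_lt with rfl | hr0
    · exact summable_of_ne_finset_zero (s := {0}) fun n hn => by
        have : n ≠ 0 := by simpa using hn
        simp [this]
    have hGp : ∀ n : ℕ, 0 < Real.Gamma (n + α + 1) := fun n =>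
      Real.Gamma_pos_of_pos (by linarith [(Nat.cast_nonneg n : (0:ℝ) ≤ n)])
    have hG2 := (Real.Gamma_pos_of_pos (show 0 < α + 1 by linarith))
    refine summable_of_ratio_test_tendsto_lt_one hr (Filter.Eventually.of_forall fun n => ?_) ?_
    · rw [lagPhi_zero_sq α hα]
      have := hGp n
      positivity
    · have e : ∀ n : ℕ, ‖lagPhi α (n + 1) 0 ^ 2 * r ^ (n + 1)‖ / ‖lagPhi α n 0 ^ 2 * r ^ n‖ =
          (1 + α * (1 / ((n : ℝ) + 1))) * r := by
        intro n
        rw [Real.norm_of_nonneg (by positivity), Real.norm_of_nonneg (by positivity),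
          lagPhi_zero_sq α hα, lagPhi_zero_sq α hα]
        have hp := hGp n
        have : ((n + 1 : ℕ) : ℝ) + α + 1 = (n + α + 1) + 1 := by push_cast; ring
        rw [this, Real.Gamma_add_one (by linarith [(Nat.cast_nonneg n : (0:ℝ) ≤ n)]),
          Nat.factorial_succ]
        push_cast
        have := n.factorial_ne_zero
        field_simp
        ring
      simp_rw [e]
      have := ((tendsto_one_div_add_atTop_nhds_zero_nat (𝕜 := ℝ)).const_mul α).const_add 1
      have := this.mul_const r
      simpa using this
  have hgeo := summable_geometric_of_lt_one hr0 hr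
  refine Summable.of_nonneg_of_le (fun n => by positivity) (fun n => ?_) (hsq.add hgeo)
  rw [← add_one_mul]
  refine mul_le_mul_of_nonneg_right ?_ (by positivity)
  rw [← sq_abs]
  nlinarith [sq_nonneg (|lagPhi α n 0| - 1), abs_nonneg (lagPhi α n 0)]

lemma Sdual_hasSum (α : ℝ) (hα : -1 < α) (φ : ℝ → ℍ[ℝ])
    (hm : AEStronglyMeasurable φ (lagMu α)) (hi : Integrable (fun x => ‖φ x‖ ^ 2) (lagMu α))
    (q : ℍ[ℝ]) (hq : ‖q‖ < 1) :
    HasSum (fun n : ℕ => q ^ n * (lagPhi α n 0 • ∫ x, lagPhi α n x • φ x ∂(lagMu α)))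
      (Sdual α 0 φ q) := by
  have hS : Sdual α 0 φ q = ∫ x, ∑' n : ℕ, (q ^ n * lagPhi α n 0 • (lagPhi α n x • φ x)) ∂(lagMu α) := by
    rw [lagMu_integral]
    unfold Sdual Rker
    congr 1
    ext1 x
    rw [← tsum_mul_right]
    congr 2
    ext1 n
    rw [smul_mul_assoc, mul_smul_comm, mul_smul_comm, smul_smul, mul_comm]
  have hint := lag_smul_integrable α hα φ hm hi
  have hF : ∀ n : ℕ, Integrable (fun x => q ^ n * lagPhi α n 0 • (lagPhi α n x • φ x)) (lagMu α) :=
    fun n => ((hint n).smul (lagPhi α n 0)).const_mul (q ^ n)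
  have hsum : Summable fun n : ℕ =>
      ∫ x, ‖q ^ n * lagPhi α n 0 • (lagPhi α n x • φ x)‖ ∂(lagMu α) := by
    refine Summable.of_nonneg_of_le (fun n => integral_nonneg fun x => norm_nonneg _) (fun n => ?_)
      ((lagPhi_zero_summable α hα ‖q‖ (norm_nonneg _) hq).mul_right
        (1 + ∫ x, ‖φ x‖ ^ 2 ∂(lagMu α)))
    have e : ∀ x, ‖q ^ n * lagPhi α n 0 • (lagPhi α n x • φ x)‖ =
        (|lagPhi α n 0| * ‖q‖ ^ n) * ‖lagPhi α n x • φ x‖ := fun x => by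
      rw [norm_mul, norm_pow, norm_smul (lagPhi α n 0), Real.norm_eq_abs]; ring
    simp_rw [e]
    rw [integral_const_mul]
    exact mul_le_mul_of_nonneg_left (lag_norm_bound α hα φ hm hi n) (by positivity)
  have h := hasSum_integral_of_summable_integral_norm hF hsum
  rw [hS]
  have e : (fun n : ℕ => q ^ n * (lagPhi α n 0 • ∫ x, lagPhi α n x • φ x ∂(lagMu α))) =
      fun n : ℕ => ∫ x, q ^ n * lagPhi α n 0 • (lagPhi α n x • φ x) ∂(lagMu α) := by
    funext n
    rw [← integral_smul]
    exact (integral_const_mul_of_integrable ((hint n).smul (lagPhi α n 0))).symm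
  rw [e]
  exact h

lemma quat_I_re (I : ℍ[ℝ]) (hI : I ^ 2 = -1) : I.re = 0 := by
  have h0 := congrArg QuaternionAlgebra.re hI
  have h1 := congrArg QuaternionAlgebra.imI hI
  have h2 := congrArg QuaternionAlgebra.imJ hI
  have h3 := congrArg QuaternionAlgebra.imK hI
  simp [pow_two] at h0 h1 h2 h3
  by_contra hne
  have e1 : I.imI = 0 := by
    have : I.re * I.imI = 0 := by linarith
    simpa [hne] using this
  have e2 : I.imJ = 0 := by
    have : I.re * I.imJ = 0 := by linarith
    simpa [hne] using this
  have e3 : I.imK = 0 := by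
    have : I.re * I.imK = 0 := by linarith
    simpa [hne] using this
  rw [e1, e2, e3] at h0
  nlinarith [sq_nonneg I.re]

lemma quat_inner_skew (I : ℍ[ℝ]) (hI : I ^ 2 = -1) (b c : ℍ[ℝ]) :
    inner ℝ b (I * c) = - inner ℝ (I * b) c := by
  have h := quat_I_re I hI
  simp [Quaternion.inner_def, h]
  ring

lemma quat_inner_iso (I : ℍ[ℝ]) (hI : I ^ 2 = -1) (b c : ℍ[ℝ]) :
    inner ℝ (I * b) (I * c) = inner ℝ b c := by
  rw [quat_inner_skew I hI, ← mul_assoc, ← pow_two, hI]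
  simp

lemma quat_norm_polar (I : ℍ[ℝ]) (hI : I ^ 2 = -1) (u v : ℝ) :
    ‖(u : ℍ[ℝ]) + v • I‖ ^ 2 = u ^ 2 + v ^ 2 := by
  have h := quat_I_re I hI
  have h0 := congrArg QuaternionAlgebra.re hI
  simp [pow_two, h] at h0
  rw [pow_two, ← Quaternion.normSq_eq_norm_mul_self, Quaternion.normSq_def']
  simp [h]
  nlinarith

lemma quat_pow (I : ℍ[ℝ]) (hI : I ^ 2 = -1) (r θ : ℝ) (n : ℕ) (b : ℍ[ℝ]) :
    (((r * Real.cos θ : ℝ) : ℍ[ℝ]) + (r * Real.sin θ) • I) ^ n * b =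
      r ^ n • (Real.cos (n * θ) • b + Real.sin (n * θ) • (I * b)) := by
  induction n with
  | zero => simp
  | succ n ih =>
    rw [pow_succ', mul_assoc, ih]
    have hII : I * (I * b) = - b := by rw [← mul_assoc, ← pow_two, hI]; simp
    have e : ((n + 1 : ℕ) : ℝ) * θ = n * θ + θ := by push_cast; ring
    rw [e, Real.cos_add, Real.sin_add, add_mul, Quaternion.coe_mul_eq_smul, smul_mul_assoc,
      mul_smul_comm, mul_add, mul_smul_comm, mul_smul_comm, hII]
    module

lemma int_cos_zero (k : ℤ) (hk : k ≠ 0) :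
    ∫ θ in Set.Ioo (-π) π, Real.cos (k * θ) = 0 := by
  rw [← integral_Ioc_eq_integral_Ioo, ← intervalIntegral.integral_of_le (by linarith [Real.pi_pos])]
  rw [intervalIntegral.integral_comp_mul_left (fun x => Real.cos x) (by exact_mod_cast hk)]
  simp

lemma int_sin_zero (k : ℤ) :
    ∫ θ in Set.Ioo (-π) π, Real.sin (k * θ) = 0 := by
  rw [← integral_Ioc_eq_integral_Ioo, ← intervalIntegral.integral_of_le (by linarith [Real.pi_pos])]
  by_cases hk : k = 0
  · simp [hk]
  rw [intervalIntegral.integral_comp_mul_left (fun x => Real.sin x) (by exact_mod_cast hk)]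
  simp

lemma norm_sum_polar (I : ℍ[ℝ]) (hI : I ^ 2 = -1) (r θ : ℝ) (N : ℕ) (b : ℕ → ℍ[ℝ]) :
    ‖∑ n ∈ Finset.range N, (((r * Real.cos θ : ℝ) : ℍ[ℝ]) + (r * Real.sin θ) • I) ^ n * b n‖ ^ 2 =
    ∑ n ∈ Finset.range N, ∑ m ∈ Finset.range N,
      (r ^ (n + m) * inner ℝ (b n) (b m) * Real.cos (((n - m : ℤ) : ℝ) * θ) +
        r ^ (n + m) * inner ℝ (I * b n) (b m) * Real.sin (((n - m : ℤ) : ℝ) * θ)) := by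
  rw [← real_inner_self_eq_norm_sq, sum_inner]
  refine Finset.sum_congr rfl fun n _ => ?_
  rw [inner_sum]
  refine Finset.sum_congr rfl fun m _ => ?_
  rw [quat_pow I hI, quat_pow I hI]
  have e : (((n - m : ℤ) : ℝ) * θ) = n * θ - m * θ := by push_cast; ring
  rw [e, Real.cos_sub, Real.sin_sub]
  simp only [inner_smul_right, real_inner_smul_left, inner_add_left, inner_add_right]
  rw [quat_inner_iso I hI, quat_inner_skew I hI]
  ring

lemma int_norm_sum_polar (I : ℍ[ℝ]) (hI : I ^ 2 = -1) (r : ℝ) (N : ℕ) (b : ℕ → ℍ[ℝ]) :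
    ∫ θ in Set.Ioo (-π) π,
      ‖∑ n ∈ Finset.range N, (((r * Real.cos θ : ℝ) : ℍ[ℝ]) + (r * Real.sin θ) • I) ^ n * b n‖ ^ 2 =
    ∑ n ∈ Finset.range N, 2 * π * ‖b n‖ ^ 2 * r ^ (2 * n) := by
  have hint : ∀ f : ℝ → ℝ, Continuous f → Integrable f (volume.restrict (Set.Ioo (-π) π)) :=
    fun f hf => (hf.integrableOn_Icc (a := -π) (b := π)).mono_set Set.Ioo_subset_Icc_self
  simp_rw [norm_sum_polar I hI]
  rw [integral_finsetSum _ (fun n _ => hint _ (by fun_prop))]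
  refine Finset.sum_congr rfl fun n hn => ?_
  rw [integral_finsetSum _ (fun n _ => hint _ (by fun_prop))]
  rw [Finset.sum_eq_single n]
  · rw [integral_add (hint _ (by fun_prop)) (hint _ (by fun_prop)), integral_const_mul,
      integral_const_mul, int_sin_zero, real_inner_self_eq_norm_sq]
    have hp : max (π + π) 0 = 2 * π := by rw [max_eq_left] <;> linarith [Real.pi_pos]
    simp [measureReal_def, Real.pi_pos.le]
    ring
  · intro m _ hm
    rw [integral_add (hint _ (by fun_prop)) (hint _ (by fun_prop)), integral_const_mul,
      integral_const_mul, int_sin_zero, int_cos_zero _ (by omega)]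
    simp
  · intro h; exact absurd hn h

set_option maxHeartbeats 1000000 in
lemma disc_lintegral (I : ℍ[ℝ]) (hI : I ^ 2 = -1) (N : ℕ) (b : ℕ → ℍ[ℝ]) (W : ℝ → ℝ)
    (hW : Measurable W) (hW0 : ∀ t, 0 < t → t < 1 → 0 ≤ W t) :
    ∫⁻ p in {p : ℝ × ℝ | p.1 ^ 2 + p.2 ^ 2 < 1},
      ENNReal.ofReal (‖∑ n ∈ Finset.range N, ((p.1 : ℍ[ℝ]) + p.2 • I) ^ n * b n‖ ^ 2 *
        W (p.1 ^ 2 + p.2 ^ 2)) =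
    ∑ n ∈ Finset.range N, ENNReal.ofReal (2 * π * ‖b n‖ ^ 2) *
      ∫⁻ r in Set.Ioo (0 : ℝ) 1, ENNReal.ofReal (r * (r ^ (2 * n) * W (r ^ 2))) := by
  have hD : MeasurableSet {p : ℝ × ℝ | p.1 ^ 2 + p.2 ^ 2 < 1} :=
    measurableSet_lt (by fun_prop) (by fun_prop)
  have hcont : Continuous fun p : ℝ × ℝ =>
      ‖∑ n ∈ Finset.range N, ((p.1 : ℍ[ℝ]) + p.2 • I) ^ n * b n‖ ^ 2 := by
    have : Continuous fun p : ℝ × ℝ => (p.1 : ℍ[ℝ]) :=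
      Quaternion.continuous_coe.comp continuous_fst
    fun_prop
  set g : ℝ × ℝ → ENNReal := fun p =>
    ENNReal.ofReal (‖∑ n ∈ Finset.range N, ((p.1 : ℍ[ℝ]) + p.2 • I) ^ n * b n‖ ^ 2 *
        W (p.1 ^ 2 + p.2 ^ 2)) with hg
  have hgm : Measurable g := by
    have := hcont.measurable
    fun_prop
  rw [← lintegral_indicator hD, ← lintegral_comp_polarCoord_symm, polarCoord_target,
    Measure.volume_eq_prod, ← Measure.prod_restrict]
  have hpm : Measurable fun p : ℝ × ℝ => polarCoord.symm p := by
    simp only [polarCoord_symm_apply]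
    fun_prop
  rw [lintegral_prod _ (by
    refine Measurable.aemeasurable ?_
    simp only [smul_eq_mul]
    exact (ENNReal.measurable_ofReal.comp measurable_fst).mul
      ((hgm.indicator hD).comp hpm))]
  have key : ∀ r ∈ Set.Ioi (0 : ℝ), ∫⁻ θ in Set.Ioo (-π) π, ENNReal.ofReal r •
      ({p : ℝ × ℝ | p.1 ^ 2 + p.2 ^ 2 < 1}.indicator g (polarCoord.symm (r, θ))) =
      (Set.Ioo (0 : ℝ) 1).indicator (fun r => ∑ n ∈ Finset.range N,
        ENNReal.ofReal (2 * π * ‖b n‖ ^ 2) * ENNReal.ofReal (r * (r ^ (2 * n) * W (r ^ 2)))) r := by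
    intro r hr
    have hr' : (0 : ℝ) < r := hr
    have hsq : ∀ θ : ℝ, (r * Real.cos θ) ^ 2 + (r * Real.sin θ) ^ 2 = r ^ 2 := fun θ => by
      have := Real.sin_sq_add_cos_sq θ
      linear_combination r ^ 2 * this
    by_cases h1 : r < 1
    · rw [Set.indicator_of_mem (show r ∈ Set.Ioo (0 : ℝ) 1 from ⟨hr', h1⟩)]
      have hW1 : 0 ≤ W (r ^ 2) := hW0 _ (by positivity) (by nlinarith)
      have e : ∀ θ : ℝ, ENNReal.ofReal r •
          ({p : ℝ × ℝ | p.1 ^ 2 + p.2 ^ 2 < 1}.indicator g (polarCoord.symm (r, θ))) =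
          ENNReal.ofReal (r * W (r ^ 2)) * ENNReal.ofReal (‖∑ n ∈ Finset.range N,
            (((r * Real.cos θ : ℝ) : ℍ[ℝ]) + (r * Real.sin θ) • I) ^ n * b n‖ ^ 2) := by
        intro θ
        rw [polarCoord_symm_apply, Set.indicator_of_mem
          (show (r * Real.cos θ, r * Real.sin θ) ∈ {p : ℝ × ℝ | p.1 ^ 2 + p.2 ^ 2 < 1} by
            simp only [Set.mem_ofPred_eq]; rw [hsq]; nlinarith)]
        simp only [hg, smul_eq_mul]
        rw [hsq, ← ENNReal.ofReal_mul hr'.le, ← ENNReal.ofReal_mul (by positivity)]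
        congr 1
        ring
      simp_rw [e]
      have hc2 : Continuous fun θ : ℝ => ‖∑ n ∈ Finset.range N,
            (((r * Real.cos θ : ℝ) : ℍ[ℝ]) + (r * Real.sin θ) • I) ^ n * b n‖ ^ 2 := by
        have : Continuous fun θ : ℝ => ((r * Real.cos θ : ℝ) : ℍ[ℝ]) :=
          Quaternion.continuous_coe.comp (by fun_prop)
        fun_prop
      rw [lintegral_const_mul _ (by exact ENNReal.measurable_ofReal.comp hc2.measurable),
        ← ofReal_integral_eq_lintegral_ofReal
          ((hc2.integrableOn_Icc (a := -π) (b := π)).mono_set Set.Ioo_subset_Icc_self)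
          (Filter.Eventually.of_forall fun θ => by positivity),
        int_norm_sum_polar I hI, ENNReal.ofReal_sum_of_nonneg
          (fun n _ => by have := Real.pi_pos; positivity), Finset.mul_sum]
      refine Finset.sum_congr rfl fun n _ => ?_
      have := Real.pi_pos
      rw [← ENNReal.ofReal_mul (by positivity), ← ENNReal.ofReal_mul (by positivity)]
      congr 1
      ring
    · rw [Set.indicator_of_notMem (fun h => h1 h.2)]
      have e : ∀ θ : ℝ, ENNReal.ofReal r •
          ({p : ℝ × ℝ | p.1 ^ 2 + p.2 ^ 2 < 1}.indicator g (polarCoord.symm (r, θ))) = 0 := by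
        intro θ
        rw [polarCoord_symm_apply, Set.indicator_of_notMem, smul_zero]
        simp only [Set.mem_ofPred_eq]; rw [hsq]; nlinarith
      simp_rw [e]
      simp
  rw [setLIntegral_congr_fun measurableSet_Ioi key, setLIntegral_indicator measurableSet_Ioo,
    Set.inter_eq_left.mpr (fun x hx => hx.1), lintegral_finsetSum _ (fun n _ => by fun_prop)]
  refine Finset.sum_congr rfl fun n _ => ?_
  rw [lintegral_const_mul _ (by fun_prop)]

lemma lint_sq (g : ℝ → ℝ) :
    ∫⁻ r in Set.Ioo (0 : ℝ) 1, ENNReal.ofReal (2 * r) * ENNReal.ofReal (g (r ^ 2)) =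
      ∫⁻ t in Set.Ioo (0 : ℝ) 1, ENNReal.ofReal (g t) := by
  have himg : (fun r : ℝ => r ^ 2) '' Set.Ioo (0 : ℝ) 1 = Set.Ioo 0 1 := by
    ext t
    constructor
    · rintro ⟨r, ⟨h0, h1⟩, rfl⟩
      exact ⟨by positivity, by simp only; nlinarith⟩
    · rintro ⟨h0, h1⟩
      exact ⟨Real.sqrt t, ⟨Real.sqrt_pos.mpr h0, by rw [Real.sqrt_lt' one_pos]; simpa using h1⟩,
        Real.sq_sqrt h0.le⟩
  have h := lintegral_image_eq_lintegral_abs_deriv_mul (s := Set.Ioo (0 : ℝ) 1)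
    (f := fun r : ℝ => r ^ 2) (f' := fun r => 2 * r) measurableSet_Ioo
    (fun x _ => by simpa using (hasDerivAt_pow 2 x).hasDerivWithinAt)
    (fun x hx y hy hxy => by
      have h1 : x ^ 2 = y ^ 2 := hxy
      nlinarith [hx.1, hy.1])
    (fun t => ENNReal.ofReal (g t))
  rw [himg] at h
  rw [h]
  refine setLIntegral_congr_fun measurableSet_Ioo fun r hr => ?_
  rw [abs_of_pos (by linarith [hr.1])]

lemma lint_beta (a η : ℝ) (ha : 0 < a) (hη : 0 < η) :
    ∫⁻ t in Set.Ioo (0 : ℝ) 1, ENNReal.ofReal (t ^ (a - 1) * (1 - t) ^ (η - 1)) =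
      ENNReal.ofReal (ProbabilityTheory.beta a η) := by
  have h := ProbabilityTheory.lintegral_betaPDF_eq_one ha hη
  have hb := ProbabilityTheory.beta_pos ha hη
  rw [ProbabilityTheory.lintegral_betaPDF] at h
  have e : ∀ x : ℝ, ENNReal.ofReal (1 / ProbabilityTheory.beta a η * x ^ (a - 1) * (1 - x) ^ (η - 1)) =
      ENNReal.ofReal (1 / ProbabilityTheory.beta a η) * ENNReal.ofReal (x ^ (a - 1) * (1 - x) ^ (η - 1)) := by
    intro x
    rw [← ENNReal.ofReal_mul (by positivity), mul_assoc]
  simp_rw [e] at h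
  rw [lintegral_const_mul _ (by fun_prop)] at h
  have h2 := congrArg (fun z => ENNReal.ofReal (ProbabilityTheory.beta a η) * z) h
  simp only [mul_one] at h2
  rw [← mul_assoc, ← ENNReal.ofReal_mul hb.le, mul_one_div_cancel hb.ne'] at h2
  simpa using h2

lemma beta_bound (α β η : ℝ) (hα : -1 < α) (hβ : 0 < β) (hβ1 : β ≤ 1) (hη : 0 < η) (hηα : α ≤ η)
    (n : ℕ) : Real.Gamma (n + α + 1) / n.factorial * ProbabilityTheory.beta (n + β) η ≤
      Real.Gamma (α + 1) * ProbabilityTheory.beta β η := by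
  induction n with
  | zero => simp
  | succ n ih =>
    refine le_trans ?_ ih
    have hn : (0 : ℝ) ≤ n := Nat.cast_nonneg n
    have hp1 : (0 : ℝ) < n + α + 1 := by linarith
    have hp2 : (0 : ℝ) < n + β := by linarith
    have hp3 : (0 : ℝ) < n + β + η := by linarith
    have hG1 := Real.Gamma_pos_of_pos hp1
    have hG2 := Real.Gamma_pos_of_pos hp2
    have hG3 := Real.Gamma_pos_of_pos hp3
    have hG4 := Real.Gamma_pos_of_pos hη
    unfold ProbabilityTheory.beta
    rw [show ((n + 1 : ℕ) : ℝ) + α + 1 = (n + α + 1) + 1 by push_cast; ring,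
      show ((n + 1 : ℕ) : ℝ) + β + η = (n + β + η) + 1 by push_cast; ring,
      show ((n + 1 : ℕ) : ℝ) + β = (n + β) + 1 by push_cast; ring,
      Real.Gamma_add_one hp1.ne', Real.Gamma_add_one hp2.ne', Real.Gamma_add_one hp3.ne',
      Nat.factorial_succ]
    push_cast
    have hf : (0 : ℝ) < n.factorial := by positivity
    have hratio : (n + α + 1) * (n + β) / ((n + 1) * (n + β + η)) ≤ 1 := by
      rw [div_le_one (by positivity)]
      have h1 : (α - η) * n ≤ 0 := mul_nonpos_of_nonpos_of_nonneg (by linarith) hn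
      have h2 : α * β ≤ η := by
        rcases le_total 0 α with h | h
        · nlinarith
        · nlinarith
      nlinarith
    have : (↑n + α + 1) * Gamma (↑n + α + 1) / ((↑n + 1) * ↑n.factorial) *
        ((↑n + β) * Gamma (↑n + β) * Gamma η / ((↑n + β + η) * Gamma (↑n + β + η))) =
        ((n + α + 1) * (n + β) / ((n + 1) * (n + β + η))) * (Gamma (↑n + α + 1) / ↑n.factorial *
        (Gamma (↑n + β) * Gamma η / Gamma (↑n + β + η))) := by
      field_simp
    rw [this]
    exact mul_le_of_le_one_left (by positivity) hratio

lemma coef_bound (α β η : ℝ) (hα : -1 < α) (hβ : 0 < β) (hη : 0 < η) (hηα : α ≤ η)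
    (n : ℕ) (a : ℍ[ℝ]) :
    ENNReal.ofReal (2 * π * ‖lagPhi α n 0 • a‖ ^ 2) *
      ∫⁻ r in Set.Ioo (0 : ℝ) 1, ENNReal.ofReal (r * (r ^ (2 * n) * weightBeta β η (r ^ 2))) ≤
    ENNReal.ofReal (π * ProbabilityTheory.beta (min β 1) η / Real.Gamma (α + 1)) *
      ENNReal.ofReal (‖a‖ ^ 2) := by
  have hpi := Real.pi_pos
  have hb0 : 0 < min β 1 := lt_min hβ one_pos
  have hn : (0 : ℝ) ≤ n := Nat.cast_nonneg n
  have hnb : 0 < n + min β 1 := by linarith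
  have h1 : ENNReal.ofReal 2 *
      ∫⁻ r in Set.Ioo (0 : ℝ) 1, ENNReal.ofReal (r * (r ^ (2 * n) * weightBeta β η (r ^ 2))) ≤
      ENNReal.ofReal (ProbabilityTheory.beta (n + min β 1) η) := by
    rw [← lint_beta _ _ hnb hη,
      ← lint_sq (fun t => t ^ (n + min β 1 - 1) * (1 - t) ^ (η - 1)),
      ← lintegral_const_mul _ (by unfold weightBeta; fun_prop)]
    refine setLIntegral_mono' measurableSet_Ioo fun r hr => ?_
    have hr0 : 0 < r := hr.1
    have hr1 : 0 < 1 - r ^ 2 := by nlinarith [hr.2]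
    rw [← ENNReal.ofReal_mul (p := 2) (by norm_num), ← ENNReal.ofReal_mul (p := 2 * r) (by positivity)]
    refine ENNReal.ofReal_le_ofReal ?_
    rw [← mul_assoc 2 r]
    refine mul_le_mul_of_nonneg_left ?_ (by positivity)
    unfold weightBeta
    rw [← mul_assoc]
    refine mul_le_mul_of_nonneg_right ?_ (by positivity)
    rw [show r ^ (2 * n) = (r ^ 2) ^ (n : ℝ) by rw [Real.rpow_natCast, pow_mul],
      ← Real.rpow_add (by positivity)]
    refine Real.rpow_le_rpow_of_exponent_ge (by positivity) (by linarith) ?_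
    linarith [min_le_left β 1]
  have hG := Real.Gamma_pos_of_pos (show 0 < α + 1 by linarith)
  have hGn := Real.Gamma_pos_of_pos (show 0 < n + α + 1 by linarith)
  rw [show 2 * π * ‖lagPhi α n 0 • a‖ ^ 2 = (π * ‖lagPhi α n 0 • a‖ ^ 2) * 2 by ring,
    ENNReal.ofReal_mul (by positivity), mul_assoc]
  refine (mul_le_mul_right h1 _).trans ?_
  have hb := ProbabilityTheory.beta_pos hb0 hη
  rw [← ENNReal.ofReal_mul (by positivity), ← ENNReal.ofReal_mul (by positivity)]
  refine ENNReal.ofReal_le_ofReal ?_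
  rw [norm_smul, mul_pow, Real.norm_eq_abs, sq_abs, lagPhi_zero_sq α hα]
  have h2 := beta_bound α (min β 1) η hα hb0 (min_le_right _ _) hη hηα n
  have h3 := mul_le_mul_of_nonneg_left h2
    (show 0 ≤ π * ‖a‖ ^ 2 / Real.Gamma (α + 1) ^ 2 by positivity)
  calc _ = π * ‖a‖ ^ 2 / Real.Gamma (α + 1) ^ 2 * (Real.Gamma (n + α + 1) / n.factorial *
        ProbabilityTheory.beta (n + min β 1) η) := by field_simp
    _ ≤ _ := h3
    _ = _ := by field_simp

theorem stmt_8 (α β η : ℝ) (hα : -1 < α) (hβ : 0 < β) (hη : 0 < η) (hηα : α ≤ η)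
    (I : ℍ[ℝ]) (hI : I ^ 2 = -1) :
    ∃ C : ℝ, 0 < C ∧ ∀ φ : ℝ → ℍ[ℝ],
      AEStronglyMeasurable φ (volume.restrict (Set.Ioi 0)) →
      (∫⁻ x in Set.Ioi (0 : ℝ),
        ENNReal.ofReal (‖φ x‖ ^ 2 * (x ^ α * Real.exp (-x)))) < ⊤ →
      (∫⁻ p in {p : ℝ × ℝ | p.1 ^ 2 + p.2 ^ 2 < 1},
        ENNReal.ofReal (‖Sdual α 0 φ ((p.1 : ℍ[ℝ]) + p.2 • I)‖ ^ 2 *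
          weightBeta β η (p.1 ^ 2 + p.2 ^ 2))) ≤
      ENNReal.ofReal C *
        ∫⁻ x in Set.Ioi (0 : ℝ),
          ENNReal.ofReal (‖φ x‖ ^ 2 * (x ^ α * Real.exp (-x))) := by

  have hG := Real.Gamma_pos_of_pos (show 0 < α + 1 by linarith)
  have hb := ProbabilityTheory.beta_pos (lt_min hβ one_pos) hη
  have hpi := Real.pi_pos
  refine ⟨π * ProbabilityTheory.beta (min β 1) η / Real.Gamma (α + 1), by positivity, ?_⟩
  intro φ hφ hfin
  have hm : AEStronglyMeasurable φ (lagMu α) :=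
    hφ.mono_ac (withDensity_absolutelyContinuous _ _)
  have hl := lagMu_lintegral α (fun x => ‖φ x‖ ^ 2) (fun x => by positivity)
  rw [← hl] at hfin ⊢
  have hi : Integrable (fun x => ‖φ x‖ ^ 2) (lagMu α) :=
    ⟨(hm.norm.pow 2), by
      rw [hasFiniteIntegral_iff_ofReal (Filter.Eventually.of_forall fun x => by positivity)]
      exact hfin⟩
  rw [← ofReal_integral_eq_lintegral_ofReal hi (Filter.Eventually.of_forall fun x => by positivity)]
  set a : ℕ → ℍ[ℝ] := fun n => ∫ x, lagPhi α n x • φ x ∂(lagMu α) with ha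
  have hD : MeasurableSet {p : ℝ × ℝ | p.1 ^ 2 + p.2 ^ 2 < 1} :=
    measurableSet_lt (by fun_prop) (by fun_prop)
  have hWm : Measurable (weightBeta β η) := by unfold weightBeta; fun_prop
  set F : ℕ → ℝ × ℝ → ENNReal := fun N p =>
    ENNReal.ofReal (‖∑ n ∈ Finset.range N, ((p.1 : ℍ[ℝ]) + p.2 • I) ^ n * (lagPhi α n 0 • a n)‖ ^ 2 *
      weightBeta β η (p.1 ^ 2 + p.2 ^ 2)) with hF
  have hFm : ∀ N, Measurable (F N) := by
    intro N
    have hc : Continuous fun p : ℝ × ℝ => ‖∑ n ∈ Finset.range N,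
        ((p.1 : ℍ[ℝ]) + p.2 • I) ^ n * (lagPhi α n 0 • a n)‖ ^ 2 := by
      have : Continuous fun p : ℝ × ℝ => (p.1 : ℍ[ℝ]) :=
        Quaternion.continuous_coe.comp continuous_fst
      fun_prop
    have := hc.measurable
    fun_prop
  have hbound : ∀ N, ∫⁻ p in {p : ℝ × ℝ | p.1 ^ 2 + p.2 ^ 2 < 1}, F N p ≤
      ENNReal.ofReal (π * ProbabilityTheory.beta (min β 1) η / Real.Gamma (α + 1)) *
        ENNReal.ofReal (∫ x, ‖φ x‖ ^ 2 ∂(lagMu α)) := by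
    intro N
    rw [hF]
    simp only
    rw [disc_lintegral I hI N (fun n => lagPhi α n 0 • a n) (weightBeta β η) hWm
      (fun t h0 h1 => by
        have : 0 < 1 - t := by linarith
        unfold weightBeta; positivity)]
    refine (Finset.sum_le_sum fun n _ => coef_bound α β η hα hβ hη hηα n (a n)).trans ?_
    rw [← Finset.mul_sum, ← ENNReal.ofReal_sum_of_nonneg (fun n _ => by positivity)]
    exact mul_le_mul_right (ENNReal.ofReal_le_ofReal (lag_bessel α hα φ hm hi N)) _
  calc _ ≤ ∫⁻ p in {p : ℝ × ℝ | p.1 ^ 2 + p.2 ^ 2 < 1},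
        Filter.liminf (fun N => F N p) Filter.atTop := by
        refine setLIntegral_mono' hD fun p hp => ?_
        have hp' : p.1 ^ 2 + p.2 ^ 2 < 1 := hp
        have hq : ‖(p.1 : ℍ[ℝ]) + p.2 • I‖ < 1 := by
          rw [← quat_norm_polar I hI] at hp'
          nlinarith [norm_nonneg ((p.1 : ℍ[ℝ]) + p.2 • I)]
        have hs := (Sdual_hasSum α hα φ hm hi _ hq).tendsto_sum_nat
        have ht : Filter.Tendsto (fun N => F N p) Filter.atTop (nhds (ENNReal.ofReal
            (‖Sdual α 0 φ ((p.1 : ℍ[ℝ]) + p.2 • I)‖ ^ 2 * weightBeta β η (p.1 ^ 2 + p.2 ^ 2)))) :=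
          (ENNReal.continuous_ofReal.tendsto _).comp ((hs.norm.pow 2).mul_const _)
        exact ht.liminf_eq.ge
    _ ≤ Filter.liminf (fun N => ∫⁻ p in {p : ℝ × ℝ | p.1 ^ 2 + p.2 ^ 2 < 1}, F N p)
        Filter.atTop := lintegral_liminf_le hFm
    _ ≤ _ := by
        refine (Filter.liminf_le_liminf (Filter.Eventually.of_forall hbound)).trans ?_
        rw [Filter.liminf_const]
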